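/- Let a : ℕ → ℝ be nonnegative and summable with effective dimension N(τ) := ∑'_j a_j/(a_j+τ), let σ > 0, q ∈ (0,1), let M ≥ 2 be an integer, τ_max > 0, and let Δ_q := { q^j·τ_max : j = 0, …, M−1 } with τ_min := q^{M−1}·τ_max. Let φ be a nonnegative nondecreasing function and define J(τ) := √(log M)·σ²·√(N(τ))/τ + (log M)·σ²/τ + φ²(τ). Then inf_{τ ∈ [τ_min, τ_max]} J(τ) ≥ q^{3/2} · min_{τ ∈ Δ_q} J(τ). -/

import Mathlib

/-- Every `x ∈ [q ^ m, 1]` is within a factor `q` above some power `q ^ j` with `j ≤ m`. -/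
theorem exists_pow_le_and_mul_le_pow {q x : ℝ} (hq0 : 0 ≤ q) (hq1 : q ≤ 1) (hx : x ≤ 1) {m : ℕ}
    (hm : q ^ m ≤ x) : ∃ j ≤ m, q ^ j ≤ x ∧ q * x ≤ q ^ j := by
  induction m with
  | zero => exact ⟨0, le_rfl, hm, by simpa using mul_le_one₀ hq1 (by simp at hm; linarith) hx⟩
  | succ k ih =>
    by_cases h : q ^ k ≤ x
    · obtain ⟨j, hj, hjx⟩ := ih h
      exact ⟨j, hj.trans k.le_succ, hjx⟩
    · refine ⟨k + 1, le_rfl, hm, ?_⟩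
      rw [pow_succ']
      exact mul_le_mul_of_nonneg_left (not_le.mp h).le hq0

theorem summable_div_add {a : ℕ → ℝ} (ha : ∀ j, 0 ≤ a j) (hsum : Summable a) {τ : ℝ}
    (hτ : 0 < τ) : Summable fun j => a j / (a j + τ) := by
  refine Summable.of_nonneg_of_le (fun j => ?_) (fun j => ?_) (hsum.div_const τ)
  · have := ha j
    positivity
  · have := ha j
    gcongr
    linarith

/-- The effective dimension grows by at most the factor `q⁻¹` when `τ` shrinks to `s ≥ q * τ`. -/
theorem mul_tsum_div_add_le {a : ℕ → ℝ} (ha : ∀ j, 0 ≤ a j) (hsum : Summable a) {q s τ : ℝ}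
    (hq1 : q ≤ 1) (hs : 0 < s) (hτ : 0 < τ) (hqs : q * τ ≤ s) :
    q * ∑' j, a j / (a j + s) ≤ ∑' j, a j / (a j + τ) := by
  rw [← tsum_mul_left]
  refine Summable.tsum_le_tsum (fun j => ?_) ((summable_div_add ha hsum hs).mul_left q)
    (summable_div_add ha hsum hτ)
  have h := ha j
  rw [← mul_div_assoc, div_le_div_iff₀ (by positivity) (by positivity)]
  have : q * (a j + τ) ≤ a j + s := by nlinarith
  nlinarith [mul_le_mul_of_nonneg_left this h]

theorem rpow_three_halves {q : ℝ} (hq : 0 < q) : q ^ ((3 : ℝ) / 2) = q * √q := by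
  rw [Real.sqrt_eq_rpow, show (3 : ℝ) / 2 = 1 + 1 / 2 by norm_num, Real.rpow_add hq, Real.rpow_one]

/-- Grid-comparison lemma for the adaptive test: with
`J(τ) = √(log M) σ² √(N(τ))/τ + (log M) σ²/τ + φ²(τ)` and the geometric grid
`Δ_q = {qʲ τ_max : j < M}`, `τ_min = q^{M−1} τ_max`, the infimum of `J` over
`[τ_min, τ_max]` is at least `q^{3/2}` times the minimum of `J` over the grid. -/
theorem stmt_14
    (a : ℕ → ℝ) (ha : ∀ j, 0 ≤ a j) (hsum : Summable a)
    (N : ℝ → ℝ) (hN : ∀ τ, N τ = ∑' j, a j / (a j + τ))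
    (σ q : ℝ) (hσ : 0 < σ) (hq : q ∈ Set.Ioo (0 : ℝ) 1)
    (M : ℕ) (hM : 2 ≤ M)
    (τmax τmin : ℝ) (hτmax : 0 < τmax) (hτmin : τmin = q ^ (M - 1) * τmax)
    (φ : ℝ → ℝ) (hφ0 : ∀ t, 0 ≤ φ t) (hφmono : Monotone φ)
    (J : ℝ → ℝ)
    (hJ : ∀ τ, J τ = Real.sqrt (Real.log M) * σ ^ 2 * Real.sqrt (N τ) / τ
      + Real.log M * σ ^ 2 / τ + φ τ ^ 2) :
    q ^ ((3 : ℝ) / 2) * (⨅ j : Fin M, J (q ^ (j : ℕ) * τmax)) ≤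
      ⨅ τ : Set.Icc τmin τmax, J τ := by
  obtain ⟨hq0, hq1⟩ := hq
  have hlog : 0 ≤ Real.log M := Real.log_natCast_nonneg M
  have hmin : τmin ≤ τmax := by
    rw [hτmin]
    exact mul_le_of_le_one_left hτmax.le (pow_le_one₀ hq0.le hq1.le)
  have hmin0 : 0 < τmin := by
    rw [hτmin]
    positivity
  have : Nonempty (Set.Icc τmin τmax) := ⟨⟨τmax, hmin, le_rfl⟩⟩
  refine le_ciInf fun ⟨τ, hτl, hτu⟩ => ?_
  have hτ : 0 < τ := hmin0.trans_le hτl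
  obtain ⟨j, hj, hjl, hju⟩ := exists_pow_le_and_mul_le_pow hq0.le hq1.le
    ((div_le_one hτmax).2 hτu) ((le_div_iff₀ hτmax).2 (hτmin ▸ hτl))
  rw [le_div_iff₀ hτmax] at hjl
  rw [← mul_div_assoc, div_le_iff₀ hτmax] at hju
  have hbdd : BddBelow (Set.range fun j : Fin M => J (q ^ (j : ℕ) * τmax)) :=
    (Set.finite_range _).bddBelow
  have hinf := ciInf_le hbdd (⟨j, by omega⟩ : Fin M)
  refine (mul_le_mul_of_nonneg_left hinf (by positivity)).trans ?_
  dsimp only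
  have hs : 0 < q ^ j * τmax := by positivity
  generalize q ^ j * τmax = s at hjl hju hs
  have hsqrt : √q * √(N s) ≤ √(N τ) := by
    rw [← Real.sqrt_mul hq0.le, hN, hN]
    exact Real.sqrt_le_sqrt (mul_tsum_div_add_le ha hsum hq1.le hs hτ hju)
  have hinv : q / s ≤ 1 / τ := by
    rwa [div_le_div_iff₀ hs hτ, one_mul]
  have hr1 : √q ≤ 1 := Real.sqrt_le_one.2 hq1.le
  have hφ : φ s ^ 2 ≤ φ τ ^ 2 := pow_le_pow_left₀ (hφ0 s) (hφmono hjl) 2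
  rw [rpow_three_halves hq0, hJ, hJ]
  calc q * √q * (√(Real.log M) * σ ^ 2 * √(N s) / s + Real.log M * σ ^ 2 / s + φ s ^ 2)
      = √(Real.log M) * σ ^ 2 * ((√q * √(N s)) * (q / s))
        + Real.log M * σ ^ 2 * (√q * (q / s)) + q * √q * φ s ^ 2 := by ring
    _ ≤ √(Real.log M) * σ ^ 2 * (√(N τ) * (1 / τ))
        + Real.log M * σ ^ 2 * (1 * (1 / τ)) + 1 * φ τ ^ 2 := by
      gcongr
      exact mul_le_one₀ hq1.le (Real.sqrt_nonneg q) hr1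
    _ = _ := by ring
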